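/- Let Ω ⊂ ℂⁿ be a bounded domain and let (φ_j) be a sequence of automorphisms of Ω such that no subsequence of (φ_j) converges uniformly on compact subsets of Ω to an automorphism of Ω. Then there exist a point X ∈ Ω, a point P ∈ ∂Ω, and a subsequence (φ_{j_k}) such that φ_{j_k}(X) → P as k → ∞. -/

import Mathlib

open Filter Topology Set

noncomputable section

/-- `f` is an automorphism of the domain `Ω`: a holomorphic bijection of `Ω`
onto itself with holomorphic inverse. -/
def IsAutomorphismOn {E : Type*} [NormedAddCommGroup E] [NormedSpace ℂ E]
    (Ω : Set E) (f : E → E) : Prop :=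
  DifferentiableOn ℂ f Ω ∧ Set.BijOn f Ω Ω ∧
    ∃ g : E → E, DifferentiableOn ℂ g Ω ∧ Set.BijOn g Ω Ω ∧ Set.InvOn g f Ω Ω

open Metric in
/-- Equi-Lipschitz estimate from the Schwarz lemma. -/
theorem aux_lip {E : Type*} [NormedAddCommGroup E] [NormedSpace ℂ E] {Ω : Set E} {R r : ℝ}
    (hR : ∀ x ∈ Ω, ∀ y ∈ Ω, dist x y ≤ R) {f : E → E} (hf : DifferentiableOn ℂ f Ω)
    (hm : MapsTo f Ω Ω) {x y : E} (hb : ball x r ⊆ Ω) (hy : y ∈ ball x r) :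
    dist (f y) (f x) ≤ R / r * dist y x := by
  have hr : 0 < r := nonempty_ball.1 ⟨y, hy⟩
  refine Complex.dist_le_div_mul_dist_of_mapsTo_ball (hf.mono hb) ?_ hy
  intro z hz
  exact hR _ (hm (hb hz)) _ (hm (hb (mem_ball_self hr)))

open Metric in
/-- Locally uniform limits of holomorphic maps are holomorphic. -/
theorem aux_limit {E : Type*} [NormedAddCommGroup E] [NormedSpace ℂ E] [FiniteDimensional ℂ E]
    {Ω : Set E} (ho : IsOpen Ω) {f : ℕ → E → E} {g : E → E}
    (hf : ∀ j, DifferentiableOn ℂ (f j) Ω) (h : TendstoLocallyUniformlyOn f g atTop Ω) :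
    DifferentiableOn ℂ g Ω := by
  have : ProperSpace E := FiniteDimensional.proper ℂ E
  have : CompleteSpace E := FiniteDimensional.complete ℂ E
  intro x hx
  -- uniform convergence on a ball
  obtain ⟨r, hr, hball, hcau⟩ : ∃ r > 0, ball x (2 * r) ⊆ Ω ∧
      ∀ ε > 0, ∃ N : ℕ, ∀ m ≥ N, ∀ k ≥ N,
      ∀ y ∈ ball x (2 * r), dist (f m y) (f k y) ≤ ε := by
    obtain ⟨ρ, hρ, hρb⟩ := Metric.isOpen_iff.1 ho x hx
    have hsub : closedBall x (ρ / 2) ⊆ Ω := (closedBall_subset_ball (by linarith)).trans hρb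
    have hu := (tendstoLocallyUniformlyOn_iff_forall_isCompact ho).1 h _ hsub
      (isCompact_closedBall _ _)
    have hc := Metric.uniformCauchySeqOn_iff.1 hu.uniformCauchySeqOn
    have h2 : ball x (2 * (ρ / 4)) ⊆ closedBall x (ρ / 2) :=
      (ball_subset_ball (by linarith)).trans ball_subset_closedBall
    refine ⟨ρ / 4, by positivity, h2.trans hsub, fun ε hε => ?_⟩
    obtain ⟨N, hN⟩ := hc ε hε
    exact ⟨N, fun m hm k hk y hy => (hN m hm k hk y (h2 hy)).le⟩
  have hsub : ∀ y ∈ ball x r, ball y r ⊆ ball x (2 * r) := by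
    intro y hy z hz
    have h1 := mem_ball.1 hy
    have h2 := mem_ball.1 hz
    have h3 := dist_triangle z y x
    rw [mem_ball]
    linarith
  have hdiff : ∀ j, ∀ y ∈ Ω, DifferentiableAt ℂ (f j) y := fun j y hy =>
    (hf j).differentiableAt (ho.mem_nhds hy)
  have hballr : ball x r ⊆ Ω := (ball_subset_ball (by linarith)).trans hball
  have hC : UniformCauchySeqOn (fun j => fderiv ℂ (f j)) atTop (ball x r) := by
    rw [Metric.uniformCauchySeqOn_iff]
    intro ε hε
    obtain ⟨N, hN⟩ := hcau (ε * r / 4) (by positivity)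
    refine ⟨N, fun m hm k hk y hy => ?_⟩
    have hyΩ := hballr hy
    rw [dist_eq_norm, ← fderiv_sub (hdiff m y hyΩ) (hdiff k y hyΩ)]
    have hle : ‖fderiv ℂ (f m - f k) y‖ ≤ (ε * r / 2) / r := by
      refine Complex.norm_fderiv_le_div_of_mapsTo_ball
        (((hf m).sub (hf k)).mono ((hsub y hy).trans hball)) ?_ hr
      intro z hz
      have h1 := hN m hm k hk z (hsub y hy hz)
      have h2 := hN m hm k hk y (hsub y hy (mem_ball_self hr))
      rw [dist_eq_norm] at h1 h2
      rw [mem_closedBall, dist_eq_norm]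
      have h3 := norm_sub_le (f m z - f k z) (f m y - f k y)
      simp only [Pi.sub_apply]
      linarith
    have : (ε * r / 2) / r = ε / 2 := by field_simp
    linarith
  have hpt : ∀ y ∈ ball x r, ∃ A, Tendsto (fun j => fderiv ℂ (f j) y) atTop (𝓝 A) :=
    fun y hy => cauchySeq_tendsto_of_complete (hC.cauchySeq hy)
  choose! A hA using hpt
  have hU := hC.tendstoUniformlyOn_of_tendsto hA
  exact (hasFDerivAt_of_tendstoUniformlyOn isOpen_ball hU
    (fun j y hy => (hdiff j y (hballr hy)).hasFDerivAt)
    (fun y hy => h.tendsto_at (hballr hy))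
    (mem_ball_self hr)).differentiableAt.differentiableWithinAt

open Metric in
/-- Montel's theorem for self-maps of a bounded domain. -/
theorem aux_montel {E : Type*} [NormedAddCommGroup E] [NormedSpace ℂ E] [FiniteDimensional ℂ E]
    {Ω : Set E} (ho : IsOpen Ω) (hne : Ω.Nonempty) (hb : Bornology.IsBounded Ω) {f : ℕ → E → E}
    (hf : ∀ j, DifferentiableOn ℂ (f j) Ω) (hm : ∀ j, MapsTo (f j) Ω Ω) :
    ∃ (ψ : ℕ → ℕ) (g : E → E), StrictMono ψ ∧
      TendstoLocallyUniformlyOn (fun k => f (ψ k)) g atTop Ω := by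
  have : ProperSpace E := FiniteDimensional.proper ℂ E
  obtain ⟨R, hR⟩ := Metric.isBounded_iff.1 hb
  have hR' : ∀ x ∈ Ω, ∀ y ∈ Ω, dist x y ≤ R := fun x hx y hy => hR hx hy
  have hR0 : 0 ≤ R := by
    obtain ⟨x, hx⟩ := hne
    simpa using hR' x hx x hx
  have : Nonempty Ω := hne.to_subtype
  let u := TopologicalSpace.denseSeq Ω
  have hcpt : IsCompact (Set.pi univ (fun _ : ℕ => closure Ω)) :=
    isCompact_univ_pi fun _ => hb.isCompact_closure
  obtain ⟨a, -, ψ, hψ, hlim⟩ := hcpt.tendsto_subseq (x := fun j m => f j (u m))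
    (fun j m _ => subset_closure (hm j (u m).2))
  have hlim' : ∀ m, Tendsto (fun k => f (ψ k) (u m)) atTop (𝓝 (a m)) := by
    intro m
    exact (tendsto_pi_nhds.1 hlim) m
  have hcau : ∀ x ∈ Ω, ∃ y, Tendsto (fun k => f (ψ k) x) atTop (𝓝 y) := by
    intro x hx
    apply cauchySeq_tendsto_of_complete
    obtain ⟨r, hr, hball⟩ := Metric.isOpen_iff.1 ho x hx
    rw [Metric.cauchySeq_iff']
    intro ε hε
    have hL : 0 ≤ R / r := by positivity
    obtain ⟨δ, hδ, hδr, hδε⟩ : ∃ δ > 0, δ ≤ r ∧ R / r * δ ≤ ε / 4 := by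
      refine ⟨min r (ε / 4 / (R / r + 1)), by positivity, min_le_left _ _, ?_⟩
      calc R / r * min r (ε / 4 / (R / r + 1)) ≤ (R / r + 1) * (ε / 4 / (R / r + 1)) := by
            gcongr
            · linarith
            · exact min_le_right _ _
        _ = ε / 4 := by field_simp
    obtain ⟨m, hmm⟩ : ∃ m, dist (u m) (⟨x, hx⟩ : Ω) < δ := by
      obtain ⟨m, hmm⟩ := (TopologicalSpace.denseRange_denseSeq Ω).exists_dist_lt ⟨x, hx⟩ hδ
      exact ⟨m, by rw [dist_comm]; exact hmm⟩
    have hmm' : dist (u m : E) x < δ := hmm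
    have hL2 : ∀ j, dist (f j (u m)) (f j x) ≤ ε / 4 := fun j =>
      (aux_lip hR' (hf j) (hm j) hball (mem_ball.2 (hmm'.trans_le hδr))).trans
        ((mul_le_mul_of_nonneg_left hmm'.le hL).trans hδε)
    obtain ⟨N, hN⟩ := (Metric.cauchySeq_iff'.1 (hlim' m).cauchySeq) (ε / 4) (by positivity)
    refine ⟨N, fun n hn => ?_⟩
    have h1 := hN n hn
    have h2 := hL2 (ψ n)
    have h3 := hL2 (ψ N)
    have h4 := dist_triangle4 (f (ψ n) x) (f (ψ n) (u m)) (f (ψ N) (u m)) (f (ψ N) x)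
    rw [dist_comm (f (ψ n) x) (f (ψ n) (u m))] at h4
    linarith
  choose! g hg using hcau
  refine ⟨ψ, g, hψ, ?_⟩
  rw [Metric.tendstoLocallyUniformlyOn_iff]
  intro ε hε x hx
  obtain ⟨r, hr, hball⟩ := Metric.isOpen_iff.1 ho x hx
  have hL : 0 ≤ R / r := by positivity
  obtain ⟨δ, hδ, hδr, hδε⟩ : ∃ δ > 0, δ ≤ r ∧ R / r * δ ≤ ε / 4 := by
    refine ⟨min r (ε / 4 / (R / r + 1)), by positivity, min_le_left _ _, ?_⟩
    calc R / r * min r (ε / 4 / (R / r + 1)) ≤ (R / r + 1) * (ε / 4 / (R / r + 1)) := by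
          gcongr
          · linarith
          · exact min_le_right _ _
      _ = ε / 4 := by field_simp
  have hL2 : ∀ j, ∀ y ∈ ball x δ, dist (f j y) (f j x) ≤ ε / 4 := fun j y hy =>
    (aux_lip hR' (hf j) (hm j) hball (ball_subset_ball hδr hy)).trans
      ((mul_le_mul_of_nonneg_left (mem_ball.1 hy).le hL).trans hδε)
  refine ⟨ball x δ, mem_nhdsWithin_of_mem_nhds (ball_mem_nhds x hδ), ?_⟩
  filter_upwards [Metric.tendsto_nhds.1 (hg x hx) (ε / 4) (by positivity)] with k hk y hy
  have hyΩ : y ∈ Ω := hball (ball_subset_ball hδr hy)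
  have h1 : dist (g y) (g x) ≤ ε / 4 :=
    le_of_tendsto ((hg y hyΩ).dist (hg x hx)) (Eventually.of_forall fun k => hL2 (ψ k) y hy)
  have h2 := hL2 (ψ k) y hy
  have h4 := dist_triangle4 (g y) (g x) (f (ψ k) x) (f (ψ k) y)
  rw [dist_comm (g x) (f (ψ k) x), dist_comm (f (ψ k) x) (f (ψ k) y)] at h4
  linarith

open Metric in
theorem stmt_1 {n : ℕ} (Ω : Set (EuclideanSpace ℂ (Fin n)))
    (hopen : IsOpen Ω) (hconn : IsConnected Ω) (hbdd : Bornology.IsBounded Ω)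
    (φ : ℕ → EuclideanSpace ℂ (Fin n) → EuclideanSpace ℂ (Fin n))
    (hφ : ∀ j, IsAutomorphismOn Ω (φ j))
    (hnc : ¬ ∃ (ψ : ℕ → ℕ) (g : EuclideanSpace ℂ (Fin n) → EuclideanSpace ℂ (Fin n)),
        StrictMono ψ ∧ IsAutomorphismOn Ω g ∧
        ∀ K ⊆ Ω, IsCompact K → TendstoUniformlyOn (fun k => φ (ψ k)) g atTop K) :
    ∃ X ∈ Ω, ∃ P ∈ frontier Ω, ∃ ψ : ℕ → ℕ, StrictMono ψ ∧
      Tendsto (fun k => φ (ψ k) X) atTop (𝓝 P) := by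
  by_contra hcon
  apply hnc
  choose hφd hφb θ hθd hθb hinv using hφ
  obtain ⟨ψ₁, g, hψ₁, hg⟩ := aux_montel hopen hconn.nonempty hbdd hφd (fun j => (hφb j).mapsTo)
  obtain ⟨ψ₂, h, hψ₂, hh⟩ := aux_montel hopen hconn.nonempty hbdd (f := fun k => θ (ψ₁ k))
    (fun j => hθd _) (fun j => (hθb _).mapsTo)
  have hg' : TendstoLocallyUniformlyOn (fun k => φ (ψ₁ (ψ₂ k))) g atTop Ω := by
    intro v hv x hx
    obtain ⟨t, ht, hev⟩ := hg v hv x hx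
    exact ⟨t, ht, hψ₂.tendsto_atTop.eventually hev⟩
  have hψ : StrictMono (fun k => ψ₁ (ψ₂ k)) := hψ₁.comp hψ₂
  have hgd : DifferentiableOn ℂ g Ω := aux_limit hopen (fun _ => hφd _) hg'
  have hhd : DifferentiableOn ℂ h Ω := aux_limit hopen (fun _ => hθd _) hh
  -- rename the subsequences
  set F := fun k => φ (ψ₁ (ψ₂ k)) with hF
  set T := fun k => θ (ψ₁ (ψ₂ k)) with hT
  have hFm : ∀ k, MapsTo (F k) Ω Ω := fun k => (hφb _).mapsTo
  have hTm : ∀ k, MapsTo (T k) Ω Ω := fun k => (hθb _).mapsTo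
  have hTF : ∀ k, ∀ x ∈ Ω, T k (F k x) = x := fun k => (hinv _).1
  have hFT : ∀ k, ∀ x ∈ Ω, F k (T k x) = x := fun k => (hinv _).2
  have hFg : ∀ x ∈ Ω, Tendsto (fun k => F k x) atTop (𝓝 (g x)) := fun x hx => hg'.tendsto_at hx
  have hTh : ∀ x ∈ Ω, Tendsto (fun k => T k x) atTop (𝓝 (h x)) := fun x hx => hh.tendsto_at hx
  have hgm : MapsTo g Ω Ω := by
    intro x hx
    have hcl : g x ∈ closure Ω :=
      mem_closure_of_tendsto (hFg x hx) (Eventually.of_forall fun k => hFm k hx)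
    by_contra hno
    refine hcon ⟨x, hx, g x, ⟨hcl, ?_⟩, _, hψ, hFg x hx⟩
    rwa [hopen.interior_eq]
  have hhg : ∀ x ∈ Ω, h (g x) = x := by
    intro x hx
    have h1 : Tendsto (fun k => F k x) atTop (𝓝[Ω] (g x)) :=
      tendsto_nhdsWithin_iff.2 ⟨hFg x hx, Eventually.of_forall fun k => hFm k hx⟩
    have h2 := hh.tendsto_comp (hhd.continuousOn (g x) (hgm hx)) (hgm hx) h1
    refine tendsto_nhds_unique h2 (tendsto_const_nhds.congr fun k => (hTF k x hx).symm)
  have hgh : ∀ q ∈ Ω, h q ∈ Ω → g (h q) = q := by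
    intro x hx hhx
    have h1 : Tendsto (fun k => T k x) atTop (𝓝[Ω] (h x)) :=
      tendsto_nhdsWithin_iff.2 ⟨hTh x hx, Eventually.of_forall fun k => hTm k hx⟩
    have h2 := hg'.tendsto_comp (hgd.continuousOn (h x) hhx) hhx h1
    refine tendsto_nhds_unique h2 (tendsto_const_nhds.congr fun k => (hFT k x hx).symm)
  obtain ⟨R, hR⟩ := Metric.isBounded_iff.1 hbdd
  have hR' : ∀ x ∈ Ω, ∀ y ∈ Ω, dist x y ≤ R := fun x hx y hy => hR hx hy
  have hR0 : 0 ≤ R := by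
    obtain ⟨x, hx⟩ := hconn.nonempty
    simpa using hR' x hx x hx
  have hV : Ω ⊆ Ω ∩ h ⁻¹' Ω := by
    refine hconn.isPreconnected.subset_of_closure_inter_subset
      (hhd.continuousOn.isOpen_inter_preimage hopen hopen) ?_ ?_
    · obtain ⟨x, hx⟩ := hconn.nonempty
      exact ⟨g x, hgm hx, hgm hx, by simpa [hhg x hx] using hx⟩
    · rintro q ⟨hqc, hq⟩
      refine ⟨hq, ?_⟩
      obtain ⟨ρ, hρ, hball⟩ := Metric.isOpen_iff.1 hopen q hq
      obtain ⟨r, hr, hrρ⟩ : ∃ r > 0, 3 * r ≤ ρ := ⟨ρ / 3, by positivity, by linarith⟩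
      have hL : 0 ≤ R / r := by positivity
      obtain ⟨δ, hδ, hδr, hδε⟩ : ∃ δ > 0, δ ≤ r ∧ R / r * δ ≤ r / 2 := by
        refine ⟨min r (r / 2 / (R / r + 1)), by positivity, min_le_left _ _, ?_⟩
        calc R / r * min r (r / 2 / (R / r + 1)) ≤ (R / r + 1) * (r / 2 / (R / r + 1)) := by
              gcongr
              · linarith
              · exact min_le_right _ _
          _ = r / 2 := by field_simp
      obtain ⟨p, ⟨hp, hhp⟩, hpq⟩ := Metric.mem_closure_iff.1 hqc δ hδ
      have hpb : closedBall p r ⊆ Ω := by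
        intro z hz
        apply hball
        have h1 := mem_closedBall.1 hz
        have h2 := dist_triangle z p q
        rw [dist_comm p q] at h2
        rw [mem_ball]
        linarith
      have hghp := hgh p hp hhp
      -- choose `m` with `F m (h p)` close to `p`
      obtain ⟨m, hmp⟩ : ∃ m, dist (F m (h p)) p < r / 2 := by
        have h1 := hFg (h p) hhp
        rw [hghp] at h1
        exact (Metric.tendsto_nhds.1 h1 (r / 2) (by positivity)).exists
      have hcont : Tendsto (fun j => F m (T j p)) atTop (𝓝 (F m (h p))) :=
        (((hφd _).continuousOn.continuousAt (hopen.mem_nhds hhp)).tendsto).comp (hTh p hp)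
      have hev : ∀ᶠ j in atTop, T j q ∈ T m '' closedBall p r := by
        filter_upwards [hcont.eventually (isOpen_ball.mem_nhds (mem_ball.2 hmp))] with j hj
        refine ⟨F m (T j q), ?_, hTF m _ (hTm j hq)⟩
        have h1 : dist (F m (T j q)) (F m (T j p)) ≤ R / r * dist q p :=
          aux_lip (f := fun z => F m (T j z)) hR' ((hφd _).comp (hθd _) (hTm j))
            ((hFm m).comp (hTm j)) (ball_subset_closedBall.trans hpb)
            (mem_ball.2 (hpq.trans_le hδr))
        have h2 : R / r * dist q p ≤ r / 2 :=
          (mul_le_mul_of_nonneg_left hpq.le hL).trans hδε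
        have h3 := mem_ball.1 hj
        have h4 := dist_triangle (F m (T j q)) (F m (T j p)) p
        rw [mem_closedBall]
        linarith
      have hK : IsCompact (T m '' closedBall p r) :=
        (isCompact_closedBall p r).image_of_continuousOn ((hθd _).continuousOn.mono hpb)
      obtain ⟨z, hz, hzq⟩ := hK.isClosed.mem_of_tendsto (hTh q hq) hev
      change h q ∈ Ω
      rw [← hzq]
      exact hTm m (hpb hz)
  have hhm : MapsTo h Ω Ω := fun x hx => (hV hx).2
  have hgh' : ∀ q ∈ Ω, g (h q) = q := fun q hq => hgh q hq (hhm hq)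
  have hI : InvOn h g Ω Ω := ⟨hhg, hgh'⟩
  refine ⟨_, g, hψ, ⟨hgd, hI.bijOn hgm hhm, h, hhd, hI.symm.bijOn hhm hgm, hI⟩, ?_⟩
  exact (tendstoLocallyUniformlyOn_iff_forall_isCompact hopen).1 hg'
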